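/- In the polynomial ring ℂ[∂_1,…,∂_5], the ideal I = ⟨∂_1∂_3, ∂_1∂_4, ∂_2∂_3, ∂_2∂_4, ∂_3∂_4, ∂_1⁴∂_2³ − ∂_1∂_5, ∂_1³∂_2⁴ − ∂_2∂_5, ∂_3⁴ − ∂_3∂_5, ∂_4⁴ − ∂_4∂_5²⟩ equals the intersection P_1 ∩ P_2 ∩ P_3 ∩ P_4, where P_1 = ⟨∂_3³ − ∂_5, ∂_1, ∂_2, ∂_4⟩, P_2 = ⟨∂_4³ − ∂_5², ∂_1, ∂_2, ∂_3⟩, P_3 = ⟨∂_1³∂_2³ − ∂_5, ∂_3, ∂_4⟩ and P_4 = ⟨∂_1, ∂_2, ∂_3, ∂_4⟩; moreover each P_i is a prime ideal. -/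

import Mathlib

open MvPolynomial

noncomputable section

abbrev R5 : Type := MvPolynomial (Fin 5) ℂ

def d1 : R5 := X 0
def d2 : R5 := X 1
def d3 : R5 := X 2
def d4 : R5 := X 3
def d5 : R5 := X 4

lemma prime_of_retract (P : Ideal R5) (v : Fin 5 → R5)
    (h1 : ∀ p ∈ P, aeval (R := ℂ) v p = 0) (h2 : ∀ i, X i - v i ∈ P) : P.IsPrime := by
  have key : ∀ p : R5, p - aeval (R := ℂ) v p ∈ P := by
    intro p
    induction p using MvPolynomial.induction_on with
    | C a => simp [MvPolynomial.algebraMap_eq]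
    | add p q hp hq =>
      have := P.add_mem hp hq
      rw [map_add]
      convert this using 1
      ring
    | mul_X p i hp =>
      have := P.add_mem (P.mul_mem_right (X i) hp) (P.mul_mem_left (aeval (R := ℂ) v p) (h2 i))
      rw [map_mul, aeval_X]
      convert this using 1
      ring
  have : P = RingHom.ker (aeval (R := ℂ) v : R5 →ₐ[ℂ] R5) := by
    ext p
    rw [RingHom.mem_ker]
    refine ⟨h1 p, fun h => ?_⟩
    have := key p
    rwa [h, sub_zero] at this
  rw [this]
  exact RingHom.ker_isPrime _

lemma ker_of_gens (S : Set R5) {T : Type*} [CommRing T] [Algebra ℂ T] (φ : R5 →ₐ[ℂ] T)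
    (h : ∀ p ∈ S, φ p = 0) : ∀ p ∈ Ideal.span S, φ p = 0 := by
  have : Ideal.span S ≤ RingHom.ker φ := Ideal.span_le.2 fun p hp => h p hp
  exact fun p hp => this hp

lemma zero1 : ∀ p ∈ Ideal.span ({d3 ^ 3 - d5, d1, d2, d4} : Set R5),
    aeval (R := ℂ) (![0, 0, d3, 0, d3 ^ 3] : Fin 5 → R5) p = 0 := by
  apply ker_of_gens
  simp [d1, d2, d3, d4, d5]

lemma zero3 : ∀ p ∈ Ideal.span ({d1 ^ 3 * d2 ^ 3 - d5, d3, d4} : Set R5),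
    aeval (R := ℂ) (![d1, d2, 0, 0, d1 ^ 3 * d2 ^ 3] : Fin 5 → R5) p = 0 := by
  apply ker_of_gens
  simp [d1, d2, d3, d4, d5]

lemma zero4 : ∀ p ∈ Ideal.span ({d1, d2, d3, d4} : Set R5),
    aeval (R := ℂ) (![0, 0, 0, 0, d5] : Fin 5 → R5) p = 0 := by
  apply ker_of_gens
  simp [d1, d2, d3, d4, d5]

lemma prime1 : (Ideal.span ({d3 ^ 3 - d5, d1, d2, d4} : Set R5)).IsPrime := by
  apply prime_of_retract _ _ zero1
  intro i
  fin_cases i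
  · simpa using Ideal.subset_span (by simp [d1])
  · simpa using Ideal.subset_span (by simp [d2])
  · simp [d3]
  · simpa using Ideal.subset_span (by simp [d4])
  · rw [← neg_mem_iff]
    exact Ideal.subset_span (by simp [d5])

lemma prime3 : (Ideal.span ({d1 ^ 3 * d2 ^ 3 - d5, d3, d4} : Set R5)).IsPrime := by
  apply prime_of_retract _ _ zero3
  intro i
  fin_cases i
  · simp [d1]
  · simp [d2]
  · simpa using Ideal.subset_span (by simp [d3])
  · simpa using Ideal.subset_span (by simp [d4])
  · rw [← neg_mem_iff]
    exact Ideal.subset_span (by simp [d5])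

lemma prime4 : (Ideal.span ({d1, d2, d3, d4} : Set R5)).IsPrime := by
  apply prime_of_retract _ _ zero4
  intro i
  fin_cases i
  · simpa using Ideal.subset_span (by simp [d1])
  · simpa using Ideal.subset_span (by simp [d2])
  · simpa using Ideal.subset_span (by simp [d3])
  · simpa using Ideal.subset_span (by simp [d4])
  · simp [d5]

lemma zero2 : ∀ p ∈ Ideal.span ({d4 ^ 3 - d5 ^ 2, d1, d2, d3} : Set R5),
    aeval (R := ℂ) (![0, 0, 0, Polynomial.X ^ 2, Polynomial.X ^ 3] :
      Fin 5 → Polynomial ℂ) p = 0 := by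
  apply ker_of_gens
  simp [d1, d2, d3, d4, d5]
  ring

lemma normal2 (p : R5) : ∃ A B : Polynomial ℂ,
    p - (Polynomial.aeval d4 A + d5 * Polynomial.aeval d4 B) ∈
      Ideal.span ({d4 ^ 3 - d5 ^ 2, d1, d2, d3} : Set R5) := by
  set P := Ideal.span ({d4 ^ 3 - d5 ^ 2, d1, d2, d3} : Set R5) with hP
  have g0 : d4 ^ 3 - d5 ^ 2 ∈ P := Ideal.subset_span (by simp)
  have g1 : d1 ∈ P := Ideal.subset_span (by simp)
  have g2 : d2 ∈ P := Ideal.subset_span (by simp)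
  have g3 : d3 ∈ P := Ideal.subset_span (by simp)
  induction p using MvPolynomial.induction_on with
  | C a => exact ⟨Polynomial.C a, 0, by simp [MvPolynomial.algebraMap_eq]⟩
  | add p q hp hq =>
    obtain ⟨A, B, h⟩ := hp
    obtain ⟨A', B', h'⟩ := hq
    refine ⟨A + A', B + B', ?_⟩
    have := P.add_mem h h'
    rw [map_add, map_add]
    convert this using 1
    ring
  | mul_X p i hp =>
    obtain ⟨A, B, h⟩ := hp
    fin_cases i
    · exact ⟨0, 0, by simpa [d1] using P.mul_mem_left p g1⟩
    · exact ⟨0, 0, by simpa [d2] using P.mul_mem_left p g2⟩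
    · exact ⟨0, 0, by simpa [d3] using P.mul_mem_left p g3⟩
    · refine ⟨A * Polynomial.X, B * Polynomial.X, ?_⟩
      have := P.mul_mem_right d4 h
      rw [map_mul, map_mul, Polynomial.aeval_X]
      convert this using 1
      change p * d4 - _ = _
      ring
    · refine ⟨B * Polynomial.X ^ 3, A, ?_⟩
      have := P.sub_mem (P.mul_mem_right d5 h) (P.mul_mem_left (Polynomial.aeval d4 B) g0)
      rw [map_mul, map_pow, Polynomial.aeval_X]
      convert this using 1
      change p * d5 - _ = _
      ring

lemma expand_parity (A B : Polynomial ℂ)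
    (h : Polynomial.expand ℂ 2 A + Polynomial.X ^ 3 * Polynomial.expand ℂ 2 B = 0) :
    A = 0 ∧ B = 0 := by
  have e : ∀ C : Polynomial ℂ, (Polynomial.expand ℂ 2 C).comp (-Polynomial.X) =
      Polynomial.expand ℂ 2 C := by
    intro C
    rw [Polynomial.expand_eq_comp_X_pow, Polynomial.comp_assoc]
    simp
  have h' := congrArg (fun q => q.comp (-Polynomial.X)) h
  simp only [Polynomial.add_comp, Polynomial.mul_comp, e, Polynomial.pow_comp,
    Polynomial.X_comp, Polynomial.zero_comp] at h'
  have hA : Polynomial.expand ℂ 2 A = 0 := by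
    have : (2 : Polynomial ℂ) * Polynomial.expand ℂ 2 A = 0 := by linear_combination h + h'
    simpa using this
  have hB : Polynomial.expand ℂ 2 B = 0 := by
    rw [hA, zero_add] at h
    simpa using h
  exact ⟨(Polynomial.expand_eq_zero (by norm_num)).1 hA,
    (Polynomial.expand_eq_zero (by norm_num)).1 hB⟩

lemma prime2 : (Ideal.span ({d4 ^ 3 - d5 ^ 2, d1, d2, d3} : Set R5)).IsPrime := by
  have : Ideal.span ({d4 ^ 3 - d5 ^ 2, d1, d2, d3} : Set R5) =
      RingHom.ker (aeval (R := ℂ) (![0, 0, 0, Polynomial.X ^ 2, Polynomial.X ^ 3] :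
      Fin 5 → Polynomial ℂ)) := by
    ext p
    rw [RingHom.mem_ker]
    refine ⟨zero2 p, fun h => ?_⟩
    obtain ⟨A, B, hAB⟩ := normal2 p
    have h2 := zero2 _ hAB
    have e4 : aeval (R := ℂ) (![0, 0, 0, Polynomial.X ^ 2, Polynomial.X ^ 3] :
      Fin 5 → Polynomial ℂ) d4 = Polynomial.X ^ 2 := by simp [d4]
    have e5 : aeval (R := ℂ) (![0, 0, 0, Polynomial.X ^ 2, Polynomial.X ^ 3] :
      Fin 5 → Polynomial ℂ) d5 = Polynomial.X ^ 3 := by simp [d5]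
    have ex : ∀ C : Polynomial ℂ, Polynomial.aeval (Polynomial.X ^ 2 : Polynomial ℂ) C =
        Polynomial.expand ℂ 2 C := fun C => by
      rw [Polynomial.expand_eq_comp_X_pow, Polynomial.comp_eq_aeval]
    rw [map_sub, h, map_add, map_mul, ← Polynomial.aeval_algHom_apply,
      ← Polynomial.aeval_algHom_apply, e4, e5, zero_sub, neg_eq_zero, ex, ex] at h2
    obtain ⟨rfl, rfl⟩ := expand_parity A B h2
    simpa using hAB
  rw [this]
  exact RingHom.ker_isPrime _

lemma mem3 {a b c x : R5} : x ∈ Ideal.span ({a, b, c} : Set R5) ↔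
    ∃ p q r, x = p * a + q * b + r * c := by
  simp only [Ideal.mem_span_insert, Ideal.mem_span_singleton']
  constructor
  · rintro ⟨p, _, ⟨q, _, ⟨r, rfl⟩, rfl⟩, rfl⟩
    exact ⟨p, q, r, by ring⟩
  · rintro ⟨p, q, r, rfl⟩
    exact ⟨p, _, ⟨q, _, ⟨r, rfl⟩, rfl⟩, by ring⟩

lemma mem4 {a b c d x : R5} : x ∈ Ideal.span ({a, b, c, d} : Set R5) ↔
    ∃ p q r s, x = p * a + q * b + r * c + s * d := by
  rw [Ideal.mem_span_insert]
  simp only [mem3]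
  constructor
  · rintro ⟨p, _, ⟨q, r, s, rfl⟩, rfl⟩
    exact ⟨p, q, r, s, by ring⟩
  · rintro ⟨p, q, r, s, rfl⟩
    exact ⟨p, _, ⟨q, r, s, rfl⟩, by ring⟩

lemma d3_notMem : d3 ∉ Ideal.span ({d3 ^ 3 - d5, d1, d2, d4} : Set R5) := fun h => by
  have := zero1 _ h
  simp [d3] at this

lemma d4_notMem : d4 ∉ Ideal.span ({d4 ^ 3 - d5 ^ 2, d1, d2, d3} : Set R5) := fun h => by
  have := zero2 _ h
  simp [d4] at this

lemma f_notMem : d1 ^ 3 * d2 ^ 3 - d5 ∉ Ideal.span ({d1, d2, d3, d4} : Set R5) := fun h => by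
  have := zero4 _ h
  simp [d1, d2, d5] at this

/-- The ideal of Example 4.9 equals the intersection of the four prime ideals
`P₁ = ⟨∂₃³ − ∂₅, ∂₁, ∂₂, ∂₄⟩`, `P₂ = ⟨∂₄³ − ∂₅², ∂₁, ∂₂, ∂₃⟩`,
`P₃ = ⟨∂₁³∂₂³ − ∂₅, ∂₃, ∂₄⟩` and `P₄ = ⟨∂₁, ∂₂, ∂₃, ∂₄⟩`. -/
theorem example_prime_decomposition_five_vars :
    Ideal.span ({d1 * d3, d1 * d4, d2 * d3, d2 * d4, d3 * d4,
        d1 ^ 4 * d2 ^ 3 - d1 * d5, d1 ^ 3 * d2 ^ 4 - d2 * d5,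
        d3 ^ 4 - d3 * d5, d4 ^ 4 - d4 * d5 ^ 2} : Set R5) =
      Ideal.span ({d3 ^ 3 - d5, d1, d2, d4} : Set R5) ⊓
      Ideal.span ({d4 ^ 3 - d5 ^ 2, d1, d2, d3} : Set R5) ⊓
      Ideal.span ({d1 ^ 3 * d2 ^ 3 - d5, d3, d4} : Set R5) ⊓
      Ideal.span ({d1, d2, d3, d4} : Set R5) ∧
    (Ideal.span ({d3 ^ 3 - d5, d1, d2, d4} : Set R5)).IsPrime ∧
    (Ideal.span ({d4 ^ 3 - d5 ^ 2, d1, d2, d3} : Set R5)).IsPrime ∧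
    (Ideal.span ({d1 ^ 3 * d2 ^ 3 - d5, d3, d4} : Set R5)).IsPrime ∧
    (Ideal.span ({d1, d2, d3, d4} : Set R5)).IsPrime := by
  refine ⟨?_, prime1, prime2, prime3, prime4⟩
  set I := Ideal.span ({d1 * d3, d1 * d4, d2 * d3, d2 * d4, d3 * d4,
        d1 ^ 4 * d2 ^ 3 - d1 * d5, d1 ^ 3 * d2 ^ 4 - d2 * d5,
        d3 ^ 4 - d3 * d5, d4 ^ 4 - d4 * d5 ^ 2} : Set R5) with hI
  have i13 : d1 * d3 ∈ I := Ideal.subset_span (by simp)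
  have i14 : d1 * d4 ∈ I := Ideal.subset_span (by simp)
  have i23 : d2 * d3 ∈ I := Ideal.subset_span (by simp)
  have i24 : d2 * d4 ∈ I := Ideal.subset_span (by simp)
  have i34 : d3 * d4 ∈ I := Ideal.subset_span (by simp)
  have j1 : d1 ^ 4 * d2 ^ 3 - d1 * d5 ∈ I := Ideal.subset_span (by simp)
  have j2 : d1 ^ 3 * d2 ^ 4 - d2 * d5 ∈ I := Ideal.subset_span (by simp)
  have j3 : d3 ^ 4 - d3 * d5 ∈ I := Ideal.subset_span (by simp)
  have j4 : d4 ^ 4 - d4 * d5 ^ 2 ∈ I := Ideal.subset_span (by simp)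
  have hle : I ≤ Ideal.span ({d3 ^ 3 - d5, d1, d2, d4} : Set R5) ⊓
      Ideal.span ({d4 ^ 3 - d5 ^ 2, d1, d2, d3} : Set R5) ⊓
      Ideal.span ({d1 ^ 3 * d2 ^ 3 - d5, d3, d4} : Set R5) ⊓
      Ideal.span ({d1, d2, d3, d4} : Set R5) := by
    rw [hI]
    refine le_inf (le_inf (le_inf ?_ ?_) ?_) ?_ <;> rw [Ideal.span_le]
    · rintro x (rfl | rfl | rfl | rfl | rfl | rfl | rfl | rfl | rfl) <;> rw [SetLike.mem_coe, mem4]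
      · exact ⟨0, d3, 0, 0, by ring⟩
      · exact ⟨0, d4, 0, 0, by ring⟩
      · exact ⟨0, 0, d3, 0, by ring⟩
      · exact ⟨0, 0, d4, 0, by ring⟩
      · exact ⟨0, 0, 0, d3, by ring⟩
      · exact ⟨0, d1 ^ 3 * d2 ^ 3 - d5, 0, 0, by ring⟩
      · exact ⟨0, 0, d1 ^ 3 * d2 ^ 3 - d5, 0, by ring⟩
      · exact ⟨d3, 0, 0, 0, by ring⟩
      · exact ⟨0, 0, 0, d4 ^ 3 - d5 ^ 2, by ring⟩
    · rintro x (rfl | rfl | rfl | rfl | rfl | rfl | rfl | rfl | rfl) <;> rw [SetLike.mem_coe, mem4]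
      · exact ⟨0, d3, 0, 0, by ring⟩
      · exact ⟨0, d4, 0, 0, by ring⟩
      · exact ⟨0, 0, d3, 0, by ring⟩
      · exact ⟨0, 0, d4, 0, by ring⟩
      · exact ⟨0, 0, 0, d4, by ring⟩
      · exact ⟨0, d1 ^ 3 * d2 ^ 3 - d5, 0, 0, by ring⟩
      · exact ⟨0, 0, d1 ^ 3 * d2 ^ 3 - d5, 0, by ring⟩
      · exact ⟨0, 0, 0, d3 ^ 3 - d5, by ring⟩
      · exact ⟨d4, 0, 0, 0, by ring⟩
    · rintro x (rfl | rfl | rfl | rfl | rfl | rfl | rfl | rfl | rfl) <;> rw [SetLike.mem_coe, mem3]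
      · exact ⟨0, d1, 0, by ring⟩
      · exact ⟨0, 0, d1, by ring⟩
      · exact ⟨0, d2, 0, by ring⟩
      · exact ⟨0, 0, d2, by ring⟩
      · exact ⟨0, 0, d3, by ring⟩
      · exact ⟨d1, 0, 0, by ring⟩
      · exact ⟨d2, 0, 0, by ring⟩
      · exact ⟨0, d3 ^ 3 - d5, 0, by ring⟩
      · exact ⟨0, 0, d4 ^ 3 - d5 ^ 2, by ring⟩
    · rintro x (rfl | rfl | rfl | rfl | rfl | rfl | rfl | rfl | rfl) <;> rw [SetLike.mem_coe, mem4]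
      · exact ⟨d3, 0, 0, 0, by ring⟩
      · exact ⟨d4, 0, 0, 0, by ring⟩
      · exact ⟨0, d3, 0, 0, by ring⟩
      · exact ⟨0, d4, 0, 0, by ring⟩
      · exact ⟨0, 0, d4, 0, by ring⟩
      · exact ⟨d1 ^ 3 * d2 ^ 3 - d5, 0, 0, 0, by ring⟩
      · exact ⟨0, d1 ^ 3 * d2 ^ 3 - d5, 0, 0, by ring⟩
      · exact ⟨0, 0, d3 ^ 3 - d5, 0, by ring⟩
      · exact ⟨0, 0, 0, d4 ^ 3 - d5 ^ 2, by ring⟩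
  refine le_antisymm hle ?_
  rintro p ⟨⟨⟨h1, h2⟩, h3⟩, h4⟩
  simp only [SetLike.mem_coe] at h1 h2 h3 h4
  obtain ⟨g, h, k, e⟩ := mem3.1 h3
  have hg : g ∈ Ideal.span ({d1, d2, d3, d4} : Set R5) := by
    have : g * (d1 ^ 3 * d2 ^ 3 - d5) ∈ Ideal.span ({d1, d2, d3, d4} : Set R5) := by
      have e' : g * (d1 ^ 3 * d2 ^ 3 - d5) = p - (h * d3 + k * d4) := by rw [e]; ring
      rw [e']
      exact sub_mem h4 (mem4.2 ⟨0, 0, h, k, by ring⟩)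
    exact (prime4.mem_or_mem this).resolve_right f_notMem
  obtain ⟨a, b, c, d, rfl⟩ := mem4.1 hg
  obtain ⟨h', hh'⟩ : ∃ h', h' = h + c * (d1 ^ 3 * d2 ^ 3 - d5) := ⟨_, rfl⟩
  obtain ⟨k', hk'⟩ : ∃ k', k' = k + d * (d1 ^ 3 * d2 ^ 3 - d5) := ⟨_, rfl⟩
  have hi : a * (d1 ^ 4 * d2 ^ 3 - d1 * d5) + b * (d1 ^ 3 * d2 ^ 4 - d2 * d5) ∈ I :=
    add_mem (I.mul_mem_left _ j1) (I.mul_mem_left _ j2)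
  have ep : p = (a * (d1 ^ 4 * d2 ^ 3 - d1 * d5) + b * (d1 ^ 3 * d2 ^ 4 - d2 * d5))
      + (h' * d3 + k' * d4) := by rw [e, hh', hk']; ring
  generalize hq : a * (d1 ^ 4 * d2 ^ 3 - d1 * d5) + b * (d1 ^ 3 * d2 ^ 4 - d2 * d5) = q at hi ep
  obtain ⟨⟨⟨q1, q2⟩, -⟩, -⟩ := hle hi
  simp only [SetLike.mem_coe] at q1 q2
  have m1 : h' ∈ Ideal.span ({d3 ^ 3 - d5, d1, d2, d4} : Set R5) := by
    have : h' * d3 ∈ Ideal.span ({d3 ^ 3 - d5, d1, d2, d4} : Set R5) := by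
      have e' : h' * d3 = p - q - k' * d4 := by rw [ep]; ring
      rw [e']
      exact sub_mem (sub_mem h1 q1) (Ideal.mul_mem_left _ _ (Ideal.subset_span (by simp)))
    exact (prime1.mem_or_mem this).resolve_right d3_notMem
  have m2 : k' ∈ Ideal.span ({d4 ^ 3 - d5 ^ 2, d1, d2, d3} : Set R5) := by
    have : k' * d4 ∈ Ideal.span ({d4 ^ 3 - d5 ^ 2, d1, d2, d3} : Set R5) := by
      have e' : k' * d4 = p - q - h' * d3 := by rw [ep]; ring
      rw [e']
      exact sub_mem (sub_mem h2 q2) (Ideal.mul_mem_left _ _ (Ideal.subset_span (by simp)))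
    exact (prime2.mem_or_mem this).resolve_right d4_notMem
  obtain ⟨r1, r2, r3, r4, er⟩ := mem4.1 m1
  obtain ⟨s1, s2, s3, s4, es⟩ := mem4.1 m2
  have n1 : h' * d3 ∈ I := by
    have e' : h' * d3 = r1 * (d3 ^ 4 - d3 * d5) + r2 * (d1 * d3) + r3 * (d2 * d3)
      + r4 * (d3 * d4) := by rw [er]; ring
    rw [e']
    exact add_mem (add_mem (add_mem (I.mul_mem_left _ j3) (I.mul_mem_left _ i13))
      (I.mul_mem_left _ i23)) (I.mul_mem_left _ i34)
  have n2 : k' * d4 ∈ I := by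
    have e' : k' * d4 = s1 * (d4 ^ 4 - d4 * d5 ^ 2) + s2 * (d1 * d4) + s3 * (d2 * d4)
      + s4 * (d3 * d4) := by rw [es]; ring
    rw [e']
    exact add_mem (add_mem (add_mem (I.mul_mem_left _ j4) (I.mul_mem_left _ i14))
      (I.mul_mem_left _ i24)) (I.mul_mem_left _ i34)
  rw [ep]
  exact add_mem hi (add_mem n1 n2)
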